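/- The sphere S^n admits a smooth tangent line bundle (a rank-1 subbundle of TS^n) only if n is odd; equivalently, for n even, there is no rank-1 subbundle of the tangent bundle of S^n. -/

import Mathlib

open scoped Manifold

section HB
open Polynomial

lemma hb_poly {m : ℕ} (hm : Odd m) (Q : ℝ[X]) (ε : ℝ) (hε : 0 < ε)
    (h : ∀ t : ℝ, 0 < t → t < ε → (Q.eval t) ^ 2 = (1 + t ^ 2) ^ m) : False := by
  have h1 : Q ^ 2 = (1 + X ^ 2 : ℝ[X]) ^ m := by
    apply Polynomial.eq_of_infinite_eval_eq
    refine Set.Infinite.mono ?_ (Set.Ioo_infinite hε)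
    intro t ht
    simp [h t ht.1 ht.2]
  have h2 : (Q.map (algebraMap ℝ ℂ)) ^ 2 = ((X - C Complex.I) * (X - C (-Complex.I))) ^ m := by
    rw [← Polynomial.map_pow, h1]
    simp only [Polynomial.map_pow, Polynomial.map_add, Polynomial.map_one, Polynomial.map_X]
    congr 1
    have : (C Complex.I * C Complex.I : ℂ[X]) = -1 := by
      rw [← C_mul, Complex.I_mul_I]; simp
    simp only [C_neg]
    linear_combination this
  have h3 := congrArg (fun p : ℂ[X] => p.rootMultiplicity Complex.I) h2
  have hne : (X - C (-Complex.I) : ℂ[X]) ≠ 0 := X_sub_C_ne_zero _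
  have hne' : (X - C (Complex.I) : ℂ[X]) ≠ 0 := X_sub_C_ne_zero _
  simp only [← Polynomial.count_roots, Polynomial.roots_pow, Polynomial.roots_mul (mul_ne_zero hne' hne), roots_X_sub_C, Multiset.count_nsmul, Multiset.count_add, Multiset.count_singleton] at h3
  have : ¬ (Complex.I = -Complex.I) := by
    intro h; have := congrArg Complex.im h; norm_num at this
  simp [this] at h3
  rw [← h3] at hm
  exact (Nat.not_odd_iff_even.2 (even_two_mul _)) hm

variable {m : ℕ}

lemma hb_det_poly (A : EuclideanSpace ℝ (Fin m) →L[ℝ] EuclideanSpace ℝ (Fin m)) :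
    ∃ p : ℝ[X], p.natDegree ≤ m ∧ ∀ t : ℝ, p.eval t = (1 + t • A).det := by
  let b := (EuclideanSpace.basisFun (Fin m) ℝ).toBasis
  let M := LinearMap.toMatrix b b A.toLinearMap
  refine ⟨Matrix.det ((X : ℝ[X]) • M.map C + (1 : Matrix (Fin m) (Fin m) ℝ).map C), ?_, ?_⟩
  · simpa using Polynomial.natDegree_det_X_add_C_le M (1 : Matrix (Fin m) (Fin m) ℝ)
  · intro t
    have : (1 + t • A).det = LinearMap.det ((1 + t • A : EuclideanSpace ℝ (Fin m) →L[ℝ] EuclideanSpace ℝ (Fin m)) : EuclideanSpace ℝ (Fin m) →ₗ[ℝ] EuclideanSpace ℝ (Fin m)) := rfl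
    rw [this, ← LinearMap.det_toMatrix b, ← Polynomial.coe_evalRingHom, RingHom.map_det]
    congr 1
    have h1 : ((1 + t • A : EuclideanSpace ℝ (Fin m) →L[ℝ] EuclideanSpace ℝ (Fin m)) : EuclideanSpace ℝ (Fin m) →ₗ[ℝ] EuclideanSpace ℝ (Fin m)) = LinearMap.id + t • A.toLinearMap := rfl
    have h2 : LinearMap.toMatrix b b (LinearMap.id + t • A.toLinearMap) = 1 + t • M := by
      rw [map_add, map_smul, LinearMap.toMatrix_id]
    rw [h1, h2]
    ext i j
    by_cases hij : i = j
    · simp [hij]; ring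
    · simp [hij]; ring

lemma hb_det_pos (A : EuclideanSpace ℝ (Fin m) →L[ℝ] EuclideanSpace ℝ (Fin m)) (t : ℝ)
    (ht : |t| * ‖A‖ < 1) : 0 < (1 + t • A).det := by
  obtain ⟨p, -, hp⟩ := hb_det_poly A
  by_contra hcon
  push Not at hcon
  rw [← hp] at hcon
  have hc : ContinuousOn (fun s : ℝ => p.eval (s * t)) (Set.Icc 0 1) := by fun_prop
  have h0 : p.eval (0 * t) = 1 := by
    rw [hp, zero_mul]
    have : (1 + (0 : ℝ) • A) = ContinuousLinearMap.id ℝ (EuclideanSpace ℝ (Fin m)) := by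
      ext x; simp
    rw [this]
    exact LinearMap.det_id
  have := intermediate_value_Icc' (zero_le_one) hc
  obtain ⟨s, hs, hs0⟩ := this (show (0:ℝ) ∈ _ by simp only [one_mul, h0]; exact ⟨hcon, zero_le_one⟩)
  simp only [hp] at hs0
  have hn : ‖-((s * t) • A)‖ < 1 := by
    rw [norm_neg, norm_smul, Real.norm_eq_abs, abs_mul, abs_of_nonneg hs.1]
    nlinarith [hs.2, abs_nonneg t, norm_nonneg A, mul_nonneg (abs_nonneg t) (norm_nonneg A)]
  have hu := isUnit_one_sub_of_norm_lt_one hn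
  rw [sub_neg_eq_add] at hu
  obtain ⟨u, hu⟩ := hu
  have hd : (1 + (s * t) • A).det * (↑u⁻¹ : EuclideanSpace ℝ (Fin m) →L[ℝ] EuclideanSpace ℝ (Fin m)).det = 1 := by
    rw [← hu]
    have h2 := congrArg (fun B : EuclideanSpace ℝ (Fin m) →L[ℝ] EuclideanSpace ℝ (Fin m) => B.det) u.mul_inv
    simp only [ContinuousLinearMap.det] at h2 ⊢
    rw [← LinearMap.det_comp]
    refine Eq.trans h2 ?_
    exact LinearMap.det_id
  rw [hs0] at hd
  simp at hd


open MeasureTheory Metric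

lemma hb_lip (w : EuclideanSpace ℝ (Fin m) → EuclideanSpace ℝ (Fin m))
    (hw : ∀ y ≠ 0, ContDiffAt ℝ 1 w y)
    (hom : ∀ y, ∀ c : ℝ, 0 < c → w (c • y) = c • w y)
    (hnorm : ∀ y, ‖w y‖ = ‖y‖) :
    ∃ K : ℝ, 1 ≤ K ∧ (∀ y ≠ 0, ‖fderiv ℝ w y‖ ≤ K) ∧ ∀ x y, ‖w x - w y‖ ≤ K * ‖x - y‖ := by
  have hinv : ∀ y ≠ 0, ∀ c : ℝ, 0 < c → fderiv ℝ w (c • y) = fderiv ℝ w y := by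
    intro y hy c hc
    have h1 : HasFDerivAt w (fderiv ℝ w (c • y)) (c • y) :=
      ((hw _ (smul_ne_zero hc.ne' hy)).differentiableAt one_ne_zero).hasFDerivAt
    have h2 : HasFDerivAt (fun y : EuclideanSpace ℝ (Fin m) => c • y)
      (c • ContinuousLinearMap.id ℝ (EuclideanSpace ℝ (Fin m))) y := (hasFDerivAt_id y).const_smul c
    have h3 := (h1.comp y h2).const_smul c⁻¹
    have h4 : (c⁻¹ • (w ∘ fun y => c • y)) = w := by
      funext z
      simp [hom z c hc, smul_smul, hc.ne']
    rw [h4] at h3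
    rw [h3.fderiv]
    ext z
    simp [hc.ne']
  have hcont : ContinuousOn (fun y => fderiv ℝ w y) (sphere 0 1) := by
    intro y hy
    have hy0 : y ≠ 0 := by rintro rfl; simp at hy
    exact ((hw y hy0).fderiv_right (m := 0) (by simp)).continuousAt.continuousWithinAt
  obtain ⟨C, hC⟩ := (isCompact_sphere (0 : EuclideanSpace ℝ (Fin m)) 1).exists_bound_of_continuousOn hcont
  have hb : ∀ y ≠ 0, ‖fderiv ℝ w y‖ ≤ max C 1 := by
    intro y hy
    have hy' : 0 < ‖y‖⁻¹ := by positivity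
    rw [← hinv y hy _ hy']
    refine (hC _ ?_).trans (le_max_left _ _)
    simp [norm_smul, hy]
  refine ⟨max C 1, le_max_right _ _, hb, ?_⟩
  intro x y
  by_cases h0 : (0 : EuclideanSpace ℝ (Fin m)) ∈ segment ℝ x y
  · have h1 := dist_add_dist_of_mem_segment h0
    rw [dist_zero_right, dist_zero_left, dist_eq_norm] at h1
    calc ‖w x - w y‖ ≤ ‖w x‖ + ‖w y‖ := norm_sub_le _ _
      _ = 1 * ‖x - y‖ := by rw [hnorm, hnorm, h1, one_mul]
      _ ≤ _ := by gcongr; exact le_max_right _ _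
  · have hne : ∀ z ∈ segment ℝ x y, z ≠ 0 := fun z hz h => h0 (h ▸ hz)
    exact (convex_segment x y).norm_image_sub_le_of_norm_fderiv_le (𝕜 := ℝ)
      (fun z hz => (hw z (hne z hz)).differentiableAt one_ne_zero) (fun z hz => hb z (hne z hz))
      (right_mem_segment ℝ x y) (left_mem_segment ℝ x y)

lemma hb_vol (hm : 0 < m) (w : EuclideanSpace ℝ (Fin m) → EuclideanSpace ℝ (Fin m))
    (hw : ∀ y ≠ 0, ContDiffAt ℝ 1 w y)
    (hnorm : ∀ y, ‖w y‖ = ‖y‖) (horth : ∀ y, inner ℝ y (w y) = 0)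
    (K : ℝ) (hK : 1 ≤ K) (hKd : ∀ y ≠ 0, ‖fderiv ℝ w y‖ ≤ K)
    (hKl : ∀ x y, ‖w x - w y‖ ≤ K * ‖x - y‖) (t : ℝ) (ht0 : 0 < t) (ht : t * K < 1) :
    IntegrableOn (fun y => (1 + t • fderiv ℝ w y).det) (ball 0 1 \ {0}) ∧
    ∫ y in (ball (0 : EuclideanSpace ℝ (Fin m)) 1 \ {0}), (1 + t • fderiv ℝ w y).det =
      √(1 + t ^ 2) ^ m * volume.real (ball (0 : EuclideanSpace ℝ (Fin m)) 1) := by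
  have : Nonempty (Fin m) := ⟨⟨0, hm⟩⟩
  let F : EuclideanSpace ℝ (Fin m) → EuclideanSpace ℝ (Fin m) := fun y => y + t • w y
  have hFn : ∀ y, ‖F y‖ = √(1 + t ^ 2) * ‖y‖ := by
    intro y
    have h1 : ‖F y‖ ^ 2 = (√(1 + t ^ 2) * ‖y‖) ^ 2 := by
      rw [mul_pow, Real.sq_sqrt (by positivity)]
      simp only [F]
      rw [norm_add_sq_real, inner_smul_right, horth, norm_smul, hnorm, mul_pow, Real.norm_eq_abs, sq_abs]
      ring
    exact (pow_left_inj₀ (norm_nonneg _) (by positivity) two_ne_zero).1 h1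
  have happ : ApproximatesLinearOn F ((ContinuousLinearEquiv.refl ℝ (EuclideanSpace ℝ (Fin m)) : EuclideanSpace ℝ (Fin m) ≃L[ℝ] EuclideanSpace ℝ (Fin m)) : EuclideanSpace ℝ (Fin m) →L[ℝ] EuclideanSpace ℝ (Fin m)) Set.univ (t * K).toNNReal := by
    refine ApproximatesLinearOn.approximatesLinearOn_iff_lipschitzOnWith.2 ?_
    apply LipschitzOnWith.of_dist_le_mul
    intro x _ y _
    rw [Real.coe_toNNReal _ (by positivity), dist_eq_norm, dist_eq_norm]
    have : (F - ⇑(ContinuousLinearEquiv.refl ℝ (EuclideanSpace ℝ (Fin m)) : EuclideanSpace ℝ (Fin m) →L[ℝ] EuclideanSpace ℝ (Fin m))) x - (F - ⇑(ContinuousLinearEquiv.refl ℝ (EuclideanSpace ℝ (Fin m)) : EuclideanSpace ℝ (Fin m) →L[ℝ] EuclideanSpace ℝ (Fin m))) y = t • (w x - w y) := by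
      simp [F, smul_sub]
    rw [this, norm_smul, Real.norm_of_nonneg ht0.le, mul_assoc]
    exact mul_le_mul_of_nonneg_left (hKl x y) ht0.le
  have hc : Subsingleton (EuclideanSpace ℝ (Fin m)) ∨ (t * K).toNNReal < ‖((ContinuousLinearEquiv.refl ℝ (EuclideanSpace ℝ (Fin m))).symm : EuclideanSpace ℝ (Fin m) →L[ℝ] EuclideanSpace ℝ (Fin m))‖₊⁻¹ := by
    right
    have : ‖((ContinuousLinearEquiv.refl ℝ (EuclideanSpace ℝ (Fin m))).symm : EuclideanSpace ℝ (Fin m) →L[ℝ] EuclideanSpace ℝ (Fin m))‖₊ = 1 := by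
      apply NNReal.eq
      exact ContinuousLinearMap.norm_id
    rw [this, inv_one]
    rw [Real.toNNReal_lt_one]; exact ht
  have hinj : Function.Injective F := Set.injOn_univ.1 (happ.injOn hc)
  have hsurj : Function.Surjective F := happ.surjective hc
  have hR : 0 < √(1 + t ^ 2) := by positivity
  have himg : F '' (ball 0 1 \ {0}) = ball 0 (√(1 + t ^ 2)) \ {0} := by
    ext z
    obtain ⟨y, rfl⟩ := hsurj z
    rw [hinj.mem_set_image]
    have e1 : F y = 0 ↔ y = 0 := by
      rw [← norm_eq_zero, hFn, mul_eq_zero, norm_eq_zero]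
      simp [hR.ne']
    have e2 : √(1 + t ^ 2) * ‖y‖ < √(1 + t ^ 2) ↔ ‖y‖ < 1 := by
      constructor <;> intro h <;> nlinarith
    simp [e1, hFn, e2]
  have hms : MeasurableSet (ball (0 : EuclideanSpace ℝ (Fin m)) 1 \ {0}) :=
    measurableSet_ball.diff (measurableSet_singleton _)
  have hd : ∀ x ∈ ball (0 : EuclideanSpace ℝ (Fin m)) 1 \ {0},
      HasFDerivWithinAt F (1 + t • fderiv ℝ w x) (ball (0 : EuclideanSpace ℝ (Fin m)) 1 \ {0}) x := by
    intro x hx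
    have hx0 : x ≠ 0 := hx.2
    have := ((hw x hx0).differentiableAt one_ne_zero).hasFDerivAt
    exact ((hasFDerivAt_id x).add (this.const_smul t)).hasFDerivWithinAt
  have hpos : ∀ x ∈ ball (0 : EuclideanSpace ℝ (Fin m)) 1 \ {0},
      |(1 + t • fderiv ℝ w x).det| = (1 + t • fderiv ℝ w x).det := by
    intro x hx
    apply abs_of_pos
    apply hb_det_pos
    rw [abs_of_pos ht0]
    exact lt_of_le_of_lt (mul_le_mul_of_nonneg_left (hKd x hx.2) ht0.le) ht
  have hI := (integrableOn_image_iff_integrableOn_abs_det_fderiv_smul volume hms hd hinj.injOn (fun _ => (1:ℝ)))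
  have hE := (integral_image_eq_integral_abs_det_fderiv_smul volume hms hd hinj.injOn (fun _ => (1:ℝ)))
  have hae : (ball (0 : EuclideanSpace ℝ (Fin m)) (√(1 + t ^ 2)) \ {0} : Set _) =ᵐ[volume] ball (0 : EuclideanSpace ℝ (Fin m)) (√(1 + t ^ 2)) :=
    sdiff_null_ae_eq_self (by simp)
  rw [himg] at hI hE
  simp only [smul_eq_mul, mul_one] at hI hE
  constructor
  · have h2 : IntegrableOn (fun _ => (1:ℝ)) (ball (0 : EuclideanSpace ℝ (Fin m)) (√(1 + t ^ 2)) \ {0}) volume :=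
      integrableOn_const (ne_top_of_le_ne_top measure_ball_lt_top.ne (measure_mono Set.sdiff_subset))
    exact (hI.1 h2).congr_fun hpos hms
  · rw [← setIntegral_congr_fun hms hpos, ← hE, setIntegral_congr_set hae]
    simp only [integral_const, smul_eq_mul, mul_one, MeasurableSet.univ, measureReal_restrict_apply, Set.univ_inter]
    rw [measureReal_def, Measure.addHaar_ball_of_pos _ _ hR, ENNReal.toReal_mul, ENNReal.toReal_ofReal (by positivity)]
    simp [measureReal_def]

lemma hb_milnor (hm : Odd m) (w : EuclideanSpace ℝ (Fin m) → EuclideanSpace ℝ (Fin m))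
    (hw : ∀ y ≠ 0, ContDiffAt ℝ 1 w y)
    (hom : ∀ y, ∀ c : ℝ, 0 < c → w (c • y) = c • w y)
    (hnorm : ∀ y, ‖w y‖ = ‖y‖) (horth : ∀ y, inner ℝ y (w y) = 0) : False := by
  obtain ⟨K, hK, hKd, hKl⟩ := hb_lip w hw hom hnorm
  have hK0 : 0 < K := by linarith
  have hvol := hb_vol hm.pos w hw hnorm horth K hK hKd hKl
  set V := volume.real (ball (0 : EuclideanSpace ℝ (Fin m)) 1) with hV
  have hVpos : 0 < V := by
    rw [hV, measureReal_def]
    exact ENNReal.toReal_pos (measure_ball_pos _ _ one_pos).ne' measure_ball_lt_top.ne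
  let ε : ℝ := K⁻¹
  have hε : 0 < ε := by positivity
  have hεt : ∀ t, t < ε → t * K < 1 := by
    intro t ht
    calc t * K < K⁻¹ * K := by gcongr
      _ = 1 := by field_simp
  let v : ℕ → ℝ := fun i => ε * ((i + 1) / (m + 2))
  have hv0 : ∀ i, 0 < v i := fun i => by positivity
  have hvε : ∀ i ∈ Finset.range (m + 1), v i < ε := by
    intro i hi
    rw [Finset.mem_range] at hi
    have : ((i : ℝ) + 1) / (m + 2) < 1 := by
      rw [div_lt_one (by positivity)]
      have : (i : ℝ) < m + 1 := by exact_mod_cast hi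
      linarith
    calc v i < ε * 1 := by simp only [v]; gcongr
      _ = ε := mul_one _
  have hvinj : Set.InjOn v (Finset.range (m + 1)) := by
    intro i _ j _ hij
    simp only [v] at hij
    have h1 := mul_left_cancel₀ hε.ne' hij
    have h2 := (div_left_inj' (by positivity : (m : ℝ) + 2 ≠ 0)).1 h1
    exact_mod_cast (add_right_cancel h2)
  let I : ℝ → ℝ := fun t => ∫ y in (ball (0 : EuclideanSpace ℝ (Fin m)) 1 \ {0}), (1 + t • fderiv ℝ w y).det
  let Q : ℝ[X] := Lagrange.interpolate (Finset.range (m + 1)) v (fun i => I (v i))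
  have hQ : ∀ t, 0 < t → t < ε → Q.eval t = I t := by
    intro t ht0 ht
    have h1 : ∀ y, (1 + t • fderiv ℝ w y).det = ∑ i ∈ Finset.range (m + 1),
        (1 + v i • fderiv ℝ w y).det * (Lagrange.basis (Finset.range (m + 1)) v i).eval t := by
      intro y
      obtain ⟨p, hp, hpe⟩ := hb_det_poly (fderiv ℝ w y)
      have h2 := Lagrange.eq_interpolate (f := p) hvinj (by
        rw [Finset.card_range]
        refine lt_of_le_of_lt Polynomial.degree_le_natDegree ?_
        exact_mod_cast Nat.lt_succ_of_le hp)
      simp only [← hpe]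
      conv_lhs => rw [h2]
      simp [Lagrange.interpolate_apply, Polynomial.eval_finsetSum]
    simp only [I, Q]
    simp_rw [h1]
    rw [integral_finsetSum]
    · simp only [integral_mul_const]
      simp only [Lagrange.interpolate_apply, Polynomial.eval_finsetSum, Polynomial.eval_mul, Polynomial.eval_C]
    · intro i hi
      exact (hvol (v i) (hv0 i) (hεt _ (hvε i hi))).1.mul_const _
  refine hb_poly hm (C V⁻¹ * Q) ε hε ?_
  intro t ht0 ht
  rw [eval_mul, eval_C, hQ t ht0 ht]
  simp only [I]
  rw [(hvol t ht0 (hεt t ht)).2]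
  have : V⁻¹ * (√(1 + t ^ 2) ^ m * V) = √(1 + t ^ 2) ^ m := by field_simp
  rw [this, ← pow_mul, mul_comm, pow_mul, Real.sq_sqrt (by positivity)]

end HB

section HC
open Metric
variable {m : ℕ}

noncomputable def hbProj (l : Submodule ℝ (EuclideanSpace ℝ (Fin m))) :
    EuclideanSpace ℝ (Fin m) →L[ℝ] EuclideanSpace ℝ (Fin m) := l.starProjection

lemma hb_line {l : Submodule ℝ (EuclideanSpace ℝ (Fin m))} (hl : Module.finrank ℝ l = 1)
    {a b : EuclideanSpace ℝ (Fin m)} (ha : a ∈ l) (hb : b ∈ l) (ha0 : a ≠ 0) :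
    ∃ c : ℝ, b = c • a := by
  have h := (finrank_eq_one_iff_of_nonzero' (⟨a, ha⟩ : l) (by simpa using ha0)).1 hl ⟨b, hb⟩
  obtain ⟨c, hc⟩ := h
  exact ⟨c, by simpa using (congrArg Subtype.val hc).symm⟩

lemma hb_inner_ne {l : Submodule ℝ (EuclideanSpace ℝ (Fin m))} (hl : Module.finrank ℝ l = 1)
    {a b : EuclideanSpace ℝ (Fin m)} (ha : a ∈ l) (hb : b ∈ l) (ha0 : a ≠ 0) (hb0 : b ≠ 0) :
    inner ℝ a b ≠ 0 := by
  obtain ⟨c, rfl⟩ := hb_line hl ha hb ha0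
  rw [inner_smul_right, real_inner_self_eq_norm_sq]
  have : c ≠ 0 := by rintro rfl; simp at hb0
  have : ‖a‖ ≠ 0 := norm_ne_zero_iff.2 ha0
  positivity

lemma hb_unit {l : Submodule ℝ (EuclideanSpace ℝ (Fin m))} (hl : Module.finrank ℝ l = 1)
    {a b : EuclideanSpace ℝ (Fin m)} (ha : a ∈ l) (hb : b ∈ l) (hab : 0 < inner ℝ a b) :
    ‖a‖⁻¹ • a = ‖b‖⁻¹ • b := by
  have ha0 : a ≠ 0 := by rintro rfl; simp at hab
  obtain ⟨c, rfl⟩ := hb_line hl ha hb ha0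
  rw [inner_smul_right, real_inner_self_eq_norm_sq] at hab
  have hn : 0 < ‖a‖ := norm_pos_iff.2 ha0
  have hc : 0 < c := pos_of_mul_pos_left hab (by positivity)
  rw [norm_smul, smul_smul, Real.norm_of_nonneg hc.le]
  congr 1
  field_simp

lemma hb_proj_cont (l : EuclideanSpace ℝ (Fin m) → Submodule ℝ (EuclideanSpace ℝ (Fin m)))
    (hl : ∀ x ≠ 0, Module.finrank ℝ (l x) = 1)
    (x : EuclideanSpace ℝ (Fin m)) (hx : x ≠ 0)
    (W : EuclideanSpace ℝ (Fin m) → EuclideanSpace ℝ (Fin m))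
    (hW : ContinuousAt W x) (hWl : ∀ᶠ y in nhds x, W y ∈ l y ∧ W y ≠ 0) :
    ContinuousAt (fun y => (l y).starProjection) x := by
  have h1 : (fun y => (l y).starProjection) =ᶠ[nhds x]
      fun y => (‖W y‖ ^ 2)⁻¹ • ContinuousLinearMap.smulRightL ℝ _ _ (innerSL ℝ (W y)) (W y) := by
    filter_upwards [hWl, isOpen_compl_singleton.mem_nhds hx] with y hy hy0
    have hs : l y = Submodule.span ℝ {W y} := by
      symm
      apply Submodule.eq_of_le_of_finrank_eq
      · rw [Submodule.span_singleton_le_iff_mem]; exact hy.1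
      · rw [hl y hy0, finrank_span_singleton hy.2]
    ext1 u
    rw [hs, Submodule.starProjection_singleton]
    simp [smul_smul, div_eq_inv_mul]
  refine ContinuousAt.congr ?_ h1.symm
  have hW0 : ‖W x‖ ^ 2 ≠ 0 := by
    have := hWl.self_of_nhds.2
    positivity
  refine ContinuousAt.smul ((hW.norm.pow 2).inv₀ hW0) ?_
  have h2 : ContinuousAt (fun y => ContinuousLinearMap.smulRightL ℝ (EuclideanSpace ℝ (Fin m)) (EuclideanSpace ℝ (Fin m)) (innerSL ℝ (W y))) x :=
    (ContinuousLinearMap.continuous _).continuousAt.comp ((innerSL ℝ).continuous.continuousAt.comp hW)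
  exact h2.clm_apply hW

lemma hb_hemi (l : EuclideanSpace ℝ (Fin m) → Submodule ℝ (EuclideanSpace ℝ (Fin m)))
    (hl : ∀ x ≠ 0, Module.finrank ℝ (l x) = 1)
    (hP : ∀ x ≠ 0, ContinuousAt (fun y => (l y).starProjection) x)
    (p : EuclideanSpace ℝ (Fin m)) (hp : ‖p‖ = 1) :
    ∃ v : EuclideanSpace ℝ (Fin m) → EuclideanSpace ℝ (Fin m),
      ContinuousOn v {x | ‖x‖ = 1 ∧ 0 ≤ inner ℝ p x} ∧
      ∀ x, ‖x‖ = 1 → 0 ≤ inner ℝ p x → v x ∈ l x ∧ v x ≠ 0 := by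
  set S : Set (EuclideanSpace ℝ (Fin m)) := {x | ‖x‖ = 1 ∧ 0 ≤ inner ℝ p x} with hS
  have hSc : IsCompact S := by
    have : S = sphere 0 1 ∩ {x | 0 ≤ inner ℝ p x} := by ext x; simp [hS]
    rw [this]
    exact (isCompact_sphere _ _).inter_right (isClosed_le continuous_const (by fun_prop))
  let g : ℝ × EuclideanSpace ℝ (Fin m) → EuclideanSpace ℝ (Fin m) := fun q => (1 - q.1) • p + q.1 • q.2
  have hg0 : ∀ t ∈ Set.Icc (0:ℝ) 1, ∀ x ∈ S, g (t, x) ≠ 0 := by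
    intro t ht x hx h
    have h1 : inner ℝ p (g (t, x)) = 0 := by rw [h, inner_zero_right]
    simp only [g, inner_add_right, inner_smul_right, real_inner_self_eq_norm_sq, hp] at h1
    have h2 := mul_nonneg ht.1 hx.2
    have h3 : t = 1 := by linarith [ht.2]
    subst h3
    simp only [g] at h
    have : x = 0 := by simpa using h
    have h4 := hx.1
    rw [this] at h4
    simp at h4
  have hG : ContinuousOn (fun q => (l (g q)).starProjection) (Set.Icc (0:ℝ) 1 ×ˢ S) := by
    rintro ⟨t, x⟩ ⟨ht, hx⟩
    have hgc : Continuous g := by fun_prop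
    exact (ContinuousAt.comp (f := g) (g := fun y => (l y).starProjection) (hP _ (hg0 t ht x hx)) hgc.continuousAt).continuousWithinAt
  have hU := (isCompact_Icc.prod hSc).uniformContinuousOn_of_continuous hG
  obtain ⟨δ, hδ, hδ'⟩ := Metric.uniformContinuousOn_iff.1 hU 1 one_pos
  obtain ⟨N, hN⟩ := exists_nat_one_div_lt hδ
  have hp0 : p ≠ 0 := by rintro rfl; simp at hp
  obtain ⟨u, hu0⟩ : ∃ u : l p, u ≠ 0 := by
    have : Nontrivial (l p) := Module.nontrivial_of_finrank_pos (R := ℝ) (by rw [hl p hp0]; exact one_pos)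
    exact exists_ne 0
  have key : ∀ k : ℕ, k ≤ N + 1 → ∃ v : EuclideanSpace ℝ (Fin m) → EuclideanSpace ℝ (Fin m),
      ContinuousOn v S ∧ ∀ x ∈ S, v x ∈ l (g ((k : ℝ) / (N + 1), x)) ∧ v x ≠ 0 := by
    intro k
    induction k with
    | zero =>
      intro _
      refine ⟨fun _ => u, continuousOn_const, fun x hx => ?_⟩
      simp [g, hu0]
    | succ k ih =>
      intro hk
      obtain ⟨v, hv, hvl⟩ := ih (by omega)
      have hN1 : (0:ℝ) < N + 1 := by positivity
      have hmem : ∀ j : ℕ, j ≤ N + 1 → (j : ℝ) / (N + 1) ∈ Set.Icc (0:ℝ) 1 := by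
        intro j hj
        refine ⟨by positivity, ?_⟩
        rw [div_le_one hN1]
        exact_mod_cast hj
      refine ⟨fun x => (l (g (((k + 1 : ℕ) : ℝ) / (N + 1), x))).starProjection (v x), ?_, ?_⟩
      · refine ContinuousOn.clm_apply ?_ hv
        exact hG.comp (f := fun x => ((((k + 1 : ℕ) : ℝ) / (N + 1)), x)) (by fun_prop)
          (fun x hx => ⟨hmem _ hk, hx⟩)
      · intro x hx
        refine ⟨Submodule.starProjection_apply_mem _ _, fun h0 => ?_⟩
        have hd := hδ' ((k : ℝ) / (N + 1), x) ⟨hmem k (by omega), hx⟩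
          (((k + 1 : ℕ) : ℝ) / (N + 1), x) ⟨hmem _ hk, hx⟩ (by
            rw [Prod.dist_eq]
            simp only [dist_self]
            rw [max_eq_left dist_nonneg, Real.dist_eq, ← sub_div, abs_div, abs_of_pos hN1]
            push_cast
            simpa using hN)
        rw [dist_eq_norm] at hd
        have h1 : (l (g ((k : ℝ) / (N + 1), x))).starProjection (v x) = v x :=
          Submodule.starProjection_eq_self_iff.2 (hvl x hx).1
        have h2 := ContinuousLinearMap.le_opNorm ((l (g ((k : ℝ) / (N + 1), x))).starProjection - (l (g (((k + 1 : ℕ) : ℝ) / (N + 1), x))).starProjection) (v x)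
        dsimp only at h0
        rw [sub_apply, h1, h0, sub_zero] at h2
        have h3 : 0 < ‖v x‖ := norm_pos_iff.2 (hvl x hx).2
        nlinarith
  obtain ⟨v, hv, hvl⟩ := key (N + 1) le_rfl
  refine ⟨v, hv, fun x hx1 hx2 => ?_⟩
  have := hvl x ⟨hx1, hx2⟩
  have e : g (((N + 1 : ℕ) : ℝ) / (N + 1), x) = x := by
    have : ((N + 1 : ℕ) : ℝ) / (N + 1) = 1 := by push_cast; field_simp
    rw [this]; simp [g]
  rwa [e] at this

lemma hb_equator {n : ℕ} (hn : 2 ≤ n) (p : EuclideanSpace ℝ (Fin (n + 1))) (hp : ‖p‖ = 1) :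
    IsPreconnected {x : EuclideanSpace ℝ (Fin (n + 1)) | ‖x‖ = 1 ∧ inner ℝ p x = 0} := by
  have : Fact (Module.finrank ℝ (EuclideanSpace ℝ (Fin (n + 1))) = n + 1) := Fact.mk (@finrank_euclideanSpace_fin ℝ _ (n + 1))
  have hp0 : p ≠ 0 := by rintro rfl; simp at hp
  have hf : Module.finrank ℝ (Submodule.span ℝ {p})ᗮ = n := Submodule.finrank_orthogonal_span_singleton hp0
  have h1 : 1 < Module.rank ℝ (Submodule.span ℝ {p})ᗮ := by
    rw [← Module.finrank_eq_rank, hf]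
    exact_mod_cast (by omega : 1 < n)
  have h2 := (isPreconnected_sphere h1 0 1).image (Subtype.val) continuous_subtype_val.continuousOn
  convert h2 using 1
  ext x
  constructor
  · rintro ⟨hx, hx2⟩
    exact ⟨⟨x, Submodule.mem_orthogonal_singleton_iff_inner_right.2 hx2⟩, by simpa using hx, rfl⟩
  · rintro ⟨y, hy, rfl⟩
    exact ⟨by simpa using hy, Submodule.mem_orthogonal_singleton_iff_inner_right.1 y.2⟩

lemma hb_global {n : ℕ} (hn : 2 ≤ n)
    (l : EuclideanSpace ℝ (Fin (n + 1)) → Submodule ℝ (EuclideanSpace ℝ (Fin (n + 1))))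
    (hl : ∀ x ≠ 0, Module.finrank ℝ (l x) = 1)
    (hP : ∀ x ≠ 0, ContinuousAt (fun y => hbProj (l y)) x) :
    ∃ u : EuclideanSpace ℝ (Fin (n + 1)) → EuclideanSpace ℝ (Fin (n + 1)),
      ContinuousOn u (sphere 0 1) ∧ ∀ x ∈ sphere (0 : EuclideanSpace ℝ (Fin (n + 1))) 1, u x ∈ l x ∧ ‖u x‖ = 1 := by
  obtain ⟨p, hp⟩ : ∃ p : EuclideanSpace ℝ (Fin (n + 1)), ‖p‖ = 1 := ⟨EuclideanSpace.single 0 1, by simp⟩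
  have hne : ∀ x : EuclideanSpace ℝ (Fin (n + 1)), ‖x‖ = 1 → x ≠ 0 := by
    rintro x hx rfl; simp at hx
  obtain ⟨v₁, hv₁, hl₁⟩ := hb_hemi l hl hP p hp
  obtain ⟨v₂, hv₂, hl₂⟩ := hb_hemi l hl hP (-p) (by rwa [norm_neg])
  simp only [inner_neg_left, Left.nonneg_neg_iff] at hv₂ hl₂
  -- choose a sign
  obtain ⟨σ, hσ0, hσ⟩ : ∃ σ : ℝ, σ ≠ 0 ∧ ∀ x, ‖x‖ = 1 → inner ℝ p x = 0 → 0 < inner ℝ (v₁ x) (σ • v₂ x) := by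
    have hc : ContinuousOn (fun x => inner ℝ (v₁ x) (v₂ x)) {x : EuclideanSpace ℝ (Fin (n + 1)) | ‖x‖ = 1 ∧ inner ℝ p x = 0} := by
      refine ContinuousOn.inner (𝕜 := ℝ) (hv₁.mono ?_) (hv₂.mono ?_)
      · rintro x ⟨h1, h2⟩; exact ⟨h1, h2.ge⟩
      · rintro x ⟨h1, h2⟩; exact ⟨h1, h2.le⟩
    have hn0 : ∀ x, ‖x‖ = 1 → inner ℝ p x = 0 → inner ℝ (v₁ x) (v₂ x) ≠ 0 := by
      intro x h1 h2
      exact hb_inner_ne (hl x (hne x h1)) (hl₁ x h1 h2.ge).1 (hl₂ x h1 h2.le).1 (hl₁ x h1 h2.ge).2 (hl₂ x h1 h2.le).2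
    by_cases hall : ∀ x, ‖x‖ = 1 → inner ℝ p x = 0 → 0 < inner ℝ (v₁ x) (v₂ x)
    · exact ⟨1, one_ne_zero, by simpa using hall⟩
    · push Not at hall
      obtain ⟨a, ha1, ha2, ha⟩ := hall
      refine ⟨-1, by norm_num, fun x hx1 hx2 => ?_⟩
      rw [inner_smul_right]
      by_contra hcon
      have hx : 0 ≤ inner ℝ (v₁ x) (v₂ x) := by linarith
      obtain ⟨z, hz, hz0⟩ := (hb_equator hn p hp).intermediate_value (a := a) (b := x) ⟨ha1, ha2⟩ ⟨hx1, hx2⟩ hc ⟨ha, hx⟩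
      exact hn0 z hz.1 hz.2 hz0
  have hl₂' : ∀ x, ‖x‖ = 1 → inner ℝ p x ≤ 0 → σ • v₂ x ∈ l x ∧ σ • v₂ x ≠ 0 := fun x h1 h2 =>
    ⟨Submodule.smul_mem _ _ (hl₂ x h1 h2).1, smul_ne_zero hσ0 (hl₂ x h1 h2).2⟩
  let u : EuclideanSpace ℝ (Fin (n + 1)) → EuclideanSpace ℝ (Fin (n + 1)) := fun x =>
    open Classical in if 0 ≤ inner ℝ p x then ‖v₁ x‖⁻¹ • v₁ x else ‖σ • v₂ x‖⁻¹ • (σ • v₂ x)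
  have hu₁ : ∀ x, 0 ≤ inner ℝ p x → u x = ‖v₁ x‖⁻¹ • v₁ x := fun x hx => by simp only [u]; rw [if_pos hx]
  have hu₂ : ∀ x, ‖x‖ = 1 → inner ℝ p x ≤ 0 → u x = ‖σ • v₂ x‖⁻¹ • (σ • v₂ x) := by
    intro x hx1 hx2
    rcases hx2.lt_or_eq with h | h
    · simp only [u]; rw [if_neg (not_le.2 h)]
    · rw [hu₁ x h.ge]
      exact hb_unit (hl x (hne x hx1)) (hl₁ x hx1 h.ge).1 (hl₂' x hx1 h.le).1 (hσ x hx1 h)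
  have hsplit : sphere (0 : EuclideanSpace ℝ (Fin (n + 1))) 1 = {x | ‖x‖ = 1 ∧ 0 ≤ inner ℝ p x} ∪ {x | ‖x‖ = 1 ∧ inner ℝ p x ≤ 0} := by
    ext x
    simp only [mem_sphere_iff_norm, sub_zero, Set.mem_union, Set.mem_ofPred_eq, ← and_or_left]
    simp [le_total]
  refine ⟨u, ?_, ?_⟩
  · rw [hsplit]
    refine ContinuousOn.union_of_isClosed ?_ ?_ ?_ ?_
    · refine ContinuousOn.congr (f := fun x => ‖v₁ x‖⁻¹ • v₁ x) ?_ (fun x hx => hu₁ x hx.2)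
      exact (hv₁.norm.inv₀ (fun x hx => norm_ne_zero_iff.2 (hl₁ x hx.1 hx.2).2)).smul hv₁
    · refine ContinuousOn.congr (f := fun x => ‖σ • v₂ x‖⁻¹ • (σ • v₂ x)) ?_ (fun x hx => hu₂ x hx.1 hx.2)
      have := hv₂.const_smul σ
      exact (this.norm.inv₀ (fun x hx => norm_ne_zero_iff.2 (hl₂' x hx.1 hx.2).2)).smul this
    · have h1 : IsClosed {x : EuclideanSpace ℝ (Fin (n + 1)) | ‖x‖ = 1} := isClosed_eq continuous_norm continuous_const
      have h2 : IsClosed {x : EuclideanSpace ℝ (Fin (n + 1)) | 0 ≤ inner ℝ p x} := isClosed_le continuous_const (by fun_prop)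
      exact h1.inter h2
    · have h1 : IsClosed {x : EuclideanSpace ℝ (Fin (n + 1)) | ‖x‖ = 1} := isClosed_eq continuous_norm continuous_const
      have h2 : IsClosed {x : EuclideanSpace ℝ (Fin (n + 1)) | inner ℝ p x ≤ 0} := isClosed_le (by fun_prop) continuous_const
      exact h1.inter h2
  · intro x hx
    rw [hsplit] at hx
    rcases hx with ⟨h1, h2⟩ | ⟨h1, h2⟩
    · rw [hu₁ x h2]
      refine ⟨Submodule.smul_mem _ _ (hl₁ x h1 h2).1, ?_⟩
      exact norm_smul_inv_norm (𝕜 := ℝ) (hl₁ x h1 h2).2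
    · rw [hu₂ x h1 h2]
      refine ⟨Submodule.smul_mem _ _ (hl₂' x h1 h2).1, ?_⟩
      exact norm_smul_inv_norm (𝕜 := ℝ) (hl₂' x h1 h2).2

lemma hb_core {n : ℕ} (hn : 2 ≤ n) (heven : Even n)
    (l : EuclideanSpace ℝ (Fin (n + 1)) → Submodule ℝ (EuclideanSpace ℝ (Fin (n + 1))))
    (hl : ∀ x ≠ 0, Module.finrank ℝ (l x) = 1)
    (hom : ∀ x ≠ 0, ∀ c : ℝ, 0 < c → l (c • x) = l x)
    (horth : ∀ x ≠ 0, ∀ v ∈ l x, inner ℝ x v = 0)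
    (hloc : ∀ x ≠ 0, ∃ W : EuclideanSpace ℝ (Fin (n + 1)) → EuclideanSpace ℝ (Fin (n + 1)),
        ContDiffAt ℝ 1 W x ∧ ∀ᶠ y in nhds x, W y ∈ l y ∧ W y ≠ 0) : False := by
  obtain ⟨u, hu, hul⟩ := hb_global hn l hl (fun x hx => by
    obtain ⟨W, hW, hWl⟩ := hloc x hx
    exact hb_proj_cont l hl x hx W hW.continuousAt hWl)
  let U : EuclideanSpace ℝ (Fin (n + 1)) → EuclideanSpace ℝ (Fin (n + 1)) := fun y => u (‖y‖⁻¹ • y)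
  have hsph : ∀ y : EuclideanSpace ℝ (Fin (n + 1)), y ≠ 0 → ‖y‖⁻¹ • y ∈ sphere (0 : EuclideanSpace ℝ (Fin (n + 1))) 1 := by
    intro y hy
    rw [mem_sphere_iff_norm, sub_zero]
    exact norm_smul_inv_norm (𝕜 := ℝ) hy
  have hUl : ∀ y ≠ 0, U y ∈ l y := by
    intro y hy
    have := (hul _ (hsph y hy)).1
    rwa [hom y hy _ (by positivity)] at this
  have hUn : ∀ y ≠ 0, ‖U y‖ = 1 := fun y hy => (hul _ (hsph y hy)).2
  have hU0 : ∀ y ≠ 0, U y ≠ 0 := by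
    intro y hy h
    have := hUn y hy
    rw [h] at this; simp at this
  have hUc : ∀ y ≠ 0, ContinuousAt U y := by
    intro y hy
    have h1 : ContinuousOn U {0}ᶜ := by
      refine hu.comp ?_ (fun z hz => hsph z hz)
      exact (continuous_norm.continuousOn.inv₀ (fun z hz => norm_ne_zero_iff.2 hz)).smul continuousOn_id
    exact h1.continuousAt (isOpen_compl_singleton.mem_nhds hy)
  have hUs : ∀ y ≠ 0, ContDiffAt ℝ 1 U y := by
    intro y hy
    obtain ⟨W, hW, hWl⟩ := hloc y hy
    have hg : ContinuousAt (fun z => inner ℝ (W z) (U z)) y := hW.continuousAt.inner (hUc y hy)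
    have hy' := hWl.self_of_nhds
    have hne : inner ℝ (W y) (U y) ≠ 0 := hb_inner_ne (hl y hy) hy'.1 (hUl y hy) hy'.2 (hU0 y hy)
    have hWs : ContDiffAt ℝ 1 (fun z => ‖W z‖⁻¹ • W z) y :=
      ((hW.norm ℝ hy'.2).inv (norm_ne_zero_iff.2 hy'.2)).smul hW
    rcases hne.lt_or_gt with hlt | hgt
    · refine hWs.neg.congr_of_eventuallyEq ?_
      filter_upwards [hWl, hg.eventually_lt_const hlt, isOpen_compl_singleton.mem_nhds hy] with z hz hz2 hz0
      have := hb_unit (hl z hz0) hz.1 (Submodule.neg_mem _ (hUl z hz0)) (by rw [inner_neg_right]; linarith)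
      rw [norm_neg, hUn z hz0, inv_one, one_smul] at this
      rw [this, neg_neg]
    · refine hWs.congr_of_eventuallyEq ?_
      filter_upwards [hWl, hg.eventually_const_lt hgt, isOpen_compl_singleton.mem_nhds hy] with z hz hz2 hz0
      have := hb_unit (hl z hz0) hz.1 (hUl z hz0) hz2
      rw [hUn z hz0, inv_one, one_smul] at this
      exact this.symm
  refine hb_milnor (heven.add_one) (fun y => ‖y‖ • U y) ?_ ?_ ?_ ?_
  · intro y hy
    exact (contDiffAt_norm ℝ hy).smul (hUs y hy)
  · intro y c hc
    have : U (c • y) = U y := by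
      simp only [U]
      congr 1
      rw [norm_smul, smul_smul, Real.norm_of_nonneg hc.le]
      congr 1
      field_simp
    simp only [this, norm_smul, Real.norm_of_nonneg hc.le, smul_smul]
  · intro y
    by_cases hy : y = 0
    · simp [hy]
    · simp [norm_smul, hUn y hy]
  · intro y
    by_cases hy : y = 0
    · simp [hy]
    · rw [inner_smul_right, horth y hy _ (hUl y hy), mul_zero]

end HC
section
open Metric

lemma hb_geom {n : ℕ} 
    (L : ∀ x : Metric.sphere (0 : EuclideanSpace ℝ (Fin (n + 1))) 1,
      Submodule ℝ (TangentSpace (𝓡 n) x))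
    (hrank : ∀ x, Module.finrank ℝ (L x) = 1)
    (hsmooth : ∀ x₀ : Metric.sphere (0 : EuclideanSpace ℝ (Fin (n + 1))) 1,
      ∃ U ∈ nhds x₀,
        ∃ s : ∀ x : Metric.sphere (0 : EuclideanSpace ℝ (Fin (n + 1))) 1,
            TangentSpace (𝓡 n) x,
          ContMDiffOn (𝓡 n) (𝓡 n).tangent (⊤ : ℕ∞)
            (fun x => (⟨x, s x⟩ :
              TangentBundle (𝓡 n) (Metric.sphere (0 : EuclideanSpace ℝ (Fin (n + 1))) 1))) U ∧
          ∀ x ∈ U, s x ∈ L x ∧ s x ≠ 0) :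
    ∃ l : EuclideanSpace ℝ (Fin (n + 1)) → Submodule ℝ (EuclideanSpace ℝ (Fin (n + 1))),
      (∀ x ≠ 0, Module.finrank ℝ (l x) = 1) ∧ (∀ x ≠ 0, ∀ c : ℝ, 0 < c → l (c • x) = l x) ∧
      (∀ x ≠ 0, ∀ v ∈ l x, inner ℝ x v = 0) ∧
      (∀ x ≠ 0, ∃ W : EuclideanSpace ℝ (Fin (n + 1)) → EuclideanSpace ℝ (Fin (n + 1)),
        ContDiffAt ℝ 1 W x ∧ ∀ᶠ y in nhds x, W y ∈ l y ∧ W y ≠ 0) := by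
  have : Fact (Module.finrank ℝ (EuclideanSpace ℝ (Fin (n + 1))) = n + 1) := Fact.mk (@finrank_euclideanSpace_fin ℝ _ (n + 1))
  let p : sphere (0 : EuclideanSpace ℝ (Fin (n + 1))) 1 := ⟨EuclideanSpace.single 0 1, by simp⟩
  let r0 : EuclideanSpace ℝ (Fin (n + 1)) → EuclideanSpace ℝ (Fin (n + 1)) := fun y =>
    open Classical in if y = 0 then p else ‖y‖⁻¹ • y
  have hr0 : ∀ y, r0 y ∈ sphere (0 : EuclideanSpace ℝ (Fin (n + 1))) 1 := by
    intro y
    by_cases hy : y = 0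
    · simp [r0, hy, -mem_sphere_iff_norm, -mem_sphere]
    · simp [r0, hy, norm_smul]
  let r : EuclideanSpace ℝ (Fin (n + 1)) → sphere (0 : EuclideanSpace ℝ (Fin (n + 1))) 1 := 
    fun y => ⟨r0 y, hr0 y⟩
  have hrval : ∀ y, y ≠ 0 → (r y : EuclideanSpace ℝ (Fin (n + 1))) = ‖y‖⁻¹ • y := by
    intro y hy; simp [r, r0, hy]
  have hrsm : ∀ y, y ≠ 0 → ContMDiffAt 𝓘(ℝ, EuclideanSpace ℝ (Fin (n + 1))) (𝓡 n) 1 r y := by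
    intro y hy
    let O : TopologicalSpace.Opens (EuclideanSpace ℝ (Fin (n + 1))) := ⟨{0}ᶜ, isOpen_compl_singleton⟩
    have hf : ContMDiff 𝓘(ℝ, EuclideanSpace ℝ (Fin (n + 1))) 𝓘(ℝ, EuclideanSpace ℝ (Fin (n + 1))) 1 (fun x : O => r0 x) := by
      intro x
      refine contMDiffAt_subtype_iff.2 ?_
      have hx : (x : EuclideanSpace ℝ (Fin (n + 1))) ≠ 0 := x.2
      have : r0 =ᶠ[nhds (x : EuclideanSpace ℝ (Fin (n + 1)))] fun y => ‖y‖⁻¹ • y := by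
        filter_upwards [isOpen_compl_singleton.mem_nhds hx] with y hy
        have hy : y ≠ 0 := hy
        simp [r0, hy]
      refine ContMDiffAt.congr_of_eventuallyEq ?_ this
      apply ContDiffAt.contMDiffAt
      exact ((contDiffAt_norm ℝ hx).inv (norm_ne_zero_iff.2 hx)).smul contDiffAt_id
    have := hf.codRestrict_sphere (n := n) (fun x => hr0 x)
    exact (contMDiffAt_subtype_iff (U := O) (f := r) (x := ⟨y, hy⟩)).1 (this ⟨y, hy⟩)
  let D : ∀ x : sphere (0 : EuclideanSpace ℝ (Fin (n + 1))) 1, TangentSpace (𝓡 n) x →L[ℝ] EuclideanSpace ℝ (Fin (n + 1)) :=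
    fun x => mfderiv (𝓡 n) 𝓘(ℝ, EuclideanSpace ℝ (Fin (n + 1))) ((↑) : sphere (0 : EuclideanSpace ℝ (Fin (n + 1))) 1 → EuclideanSpace ℝ (Fin (n + 1))) x
  have hDinj : ∀ x, Function.Injective (D x) := fun x => mfderiv_coe_sphere_injective x
  refine ⟨fun y => (L (r y)).map (D (r y)).toLinearMap, ?_, ?_, ?_, ?_⟩
  · intro x hx
    refine Eq.trans ?_ (hrank (r x))
    exact (LinearEquiv.finrank_eq (Submodule.equivMapOfInjective _ (hDinj (r x)) (L (r x)))).symm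
  · intro x hx c hc
    have : r (c • x) = r x := by
      apply Subtype.ext
      rw [hrval _ hx, hrval _ (smul_ne_zero hc.ne' hx), norm_smul, smul_smul, Real.norm_of_nonneg hc.le]
      congr 1
      field_simp
    dsimp only
    rw [this]
  · intro x hx v hv
    obtain ⟨u, -, rfl⟩ := hv
    have h1 : D (r x) u ∈ (D (r x)).range := ⟨u, rfl⟩
    have h2 := range_mfderiv_coe_sphere (n := n) (r x)
    have h3 : D (r x) u ∈ (Submodule.span ℝ {(r x : EuclideanSpace ℝ (Fin (n + 1)))})ᗮ := by
      rw [← h2]; exact h1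
    rw [Submodule.mem_orthogonal_singleton_iff_inner_right, hrval x hx, inner_smul_left] at h3
    simpa [hx] using h3
  · intro x hx
    obtain ⟨U, hU, s, hs, hsL⟩ := hsmooth (r x)
    refine ⟨fun y => D (r y) (s (r y)), ?_, ?_⟩
    · have hs1 : ContMDiffAt (𝓡 n) (𝓡 n).tangent 1
            (fun x => (⟨x, s x⟩ :
              TangentBundle (𝓡 n) (Metric.sphere (0 : EuclideanSpace ℝ (Fin (n + 1))) 1))) (r x) :=
        (hs.contMDiffAt hU).of_le (by exact_mod_cast le_top)
      have hT : ContMDiff (𝓡 n).tangent 𝓘(ℝ, EuclideanSpace ℝ (Fin (n + 1))).tangent 1 (tangentMap (𝓡 n) 𝓘(ℝ, EuclideanSpace ℝ (Fin (n + 1))) ((↑) : sphere (0 : EuclideanSpace ℝ (Fin (n + 1))) 1 → EuclideanSpace ℝ (Fin (n + 1)))) :=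
        (contMDiff_coe_sphere (m := 2) (n := n)).contMDiff_tangentMap (by norm_num)
      have hc := (contMDiff_snd_tangentBundle_modelSpace (n := 1) (EuclideanSpace ℝ (Fin (n + 1))) 𝓘(ℝ, EuclideanSpace ℝ (Fin (n + 1)))).contMDiffAt.comp x
        (hT.contMDiffAt.comp x (hs1.comp x (hrsm x hx)))
      exact hc.contDiffAt
    · have := (hrsm x hx).continuousAt.preimage_mem_nhds hU
      filter_upwards [this] with y hy
      exact ⟨⟨_, (hsL _ hy).1, rfl⟩, fun h => (hsL _ hy).2 (hDinj _ (by simpa using h))⟩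
end

theorem stmt13 {n : ℕ} (hn : 1 ≤ n) (heven : Even n)
    (L : ∀ x : Metric.sphere (0 : EuclideanSpace ℝ (Fin (n + 1))) 1,
      Submodule ℝ (TangentSpace (𝓡 n) x))
    (hrank : ∀ x, Module.finrank ℝ (L x) = 1)
    (hsmooth : ∀ x₀ : Metric.sphere (0 : EuclideanSpace ℝ (Fin (n + 1))) 1,
      ∃ U ∈ nhds x₀,
        ∃ s : ∀ x : Metric.sphere (0 : EuclideanSpace ℝ (Fin (n + 1))) 1,
            TangentSpace (𝓡 n) x,
          ContMDiffOn (𝓡 n) (𝓡 n).tangent (⊤ : ℕ∞)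
            (fun x => (⟨x, s x⟩ :
              TangentBundle (𝓡 n) (Metric.sphere (0 : EuclideanSpace ℝ (Fin (n + 1))) 1))) U ∧
          ∀ x ∈ U, s x ∈ L x ∧ s x ≠ 0) :
    False := by
  obtain ⟨l, h1, h2, h3, h4⟩ := hb_geom L hrank hsmooth
  refine hb_core ?_ heven l h1 h2 h3 h4
  obtain ⟨k, hk⟩ := heven
  omega
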